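/- Let μ > 0, u ∈ (-1,1) and p = p(μ) with 0 < p'(μ) < 1 (so μ ↦ p(μ) is injective). Define ρ = (μ+p)/(1-u²) - p, j = (μ+p)u/(1-u²), S₁₁ = (μ+p)u²/(1-u²) + p. Then the map (μ,u) ↦ (ρ, j, S₁₁) is injective on (0,∞) × (-1,1), provided μ + p(μ) > 0. -/

import Mathlib

/-- The map `(μ,u) ↦ (ρ, j, S₁₁)` given by the frame components of the perfect-fluid
energy-momentum tensor is injective on `(0,∞) × (-1,1)`, provided `p` is strictly
increasing (`0 < p' < 1`) and `μ + p(μ) > 0`. -/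
theorem stmt_11 (p : ℝ → ℝ)
    (hp : DifferentiableOn ℝ p (Set.Ioi 0))
    (hp' : ∀ μ ∈ Set.Ioi (0:ℝ), deriv p μ ∈ Set.Ioo 0 1)
    (hpos : ∀ μ ∈ Set.Ioi (0:ℝ), 0 < μ + p μ) :
    Set.InjOn (fun z : ℝ × ℝ =>
      (((z.1 + p z.1) / (1 - z.2^2) - p z.1),
       ((z.1 + p z.1) * z.2 / (1 - z.2^2)),
       ((z.1 + p z.1) * z.2^2 / (1 - z.2^2) + p z.1)))
      (Set.Ioi 0 ×ˢ Set.Ioo (-1:ℝ) 1) := by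
  rintro ⟨μ, u⟩ ⟨hμ, hu⟩ ⟨ν, v⟩ ⟨hν, hv⟩ h
  simp only [Prod.mk.injEq] at h hμ hu hν hv ⊢
  obtain ⟨hρ, hj, hS⟩ := h
  have hu' : 0 < 1 - u ^ 2 := by nlinarith [hu.1, hu.2]
  have hv' : 0 < 1 - v ^ 2 := by nlinarith [hv.1, hv.2]
  have hw := hpos μ hμ
  have hx := hpos ν hν
  obtain ⟨a, ha⟩ : ∃ a, a = (μ + p μ) / (1 - u ^ 2) := ⟨_, rfl⟩
  obtain ⟨b, hb⟩ : ∃ b, b = (ν + p ν) / (1 - v ^ 2) := ⟨_, rfl⟩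
  have ha0 : 0 < a := ha ▸ div_pos hw hu'
  have haw : a * (1 - u ^ 2) = μ + p μ := by rw [ha]; exact div_mul_cancel₀ _ hu'.ne'
  have hbx : b * (1 - v ^ 2) = ν + p ν := by rw [hb]; exact div_mul_cancel₀ _ hv'.ne'
  rw [← ha, ← hb] at hρ
  rw [mul_div_right_comm, mul_div_right_comm, ← ha, ← hb] at hj hS
  -- The enthalpy satisfies `(μ + p) ^ 2 = (ρ + S₁₁) ^ 2 - 4 * j ^ 2`.
  have hsum : a * (1 + u ^ 2) = b * (1 + v ^ 2) := by linear_combination hρ + hS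
  have hsq : (μ + p μ) ^ 2 = (ν + p ν) ^ 2 := by
    rw [← haw, ← hbx]
    linear_combination (a * (1 + u ^ 2) + b * (1 + v ^ 2)) * hsum - 4 * (a * u + b * v) * hj
  have hwx : μ + p μ = ν + p ν := (sq_eq_sq₀ hw.le hx.le).mp hsq
  have hμν : μ = ν := by
    linear_combination (1 / 2) * (hρ - hS) - (1 / 2) * (haw - hbx) + (1 / 2) * hwx
  subst hμν
  have hab : a = b := by linarith
  subst hab
  exact ⟨rfl, mul_left_cancel₀ ha0.ne' hj⟩
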